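/- For any integer k, natural number n ≥ 1, and complex x,y,τ with Im τ > 0 such that all theta functions appearing are nonzero, the summation identity holds: (1/n) ∑_{ν=0}^{n-1} exp(-2πi k ν/n) · [θ₁(x+y+ν/n;τ) θ₁'(0;τ)] / [θ₁(x;τ) θ₁(y+ν/n;τ)] = exp(2πi k y) · [θ₁(x+ny+kτ; nτ) θ₁'(0; nτ)] / [θ₁(x+kτ; nτ) θ₁(ny; nτ)]. -/

import Mathlib

open Complex Real BigOperators

/-- The Jacobi theta function `θ₁(z;τ)`. -/
noncomputable def jacobiTheta₁ (z τ : ℂ) : ℂ :=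
  -Complex.I * ∑' k : ℤ, (-1 : ℂ) ^ k *
    Complex.exp ((π : ℂ) * Complex.I * τ * ((k : ℂ) + 1 / 2) ^ 2) *
    Complex.exp (2 * (π : ℂ) * Complex.I * ((k : ℂ) + 1 / 2) * z)

/-- The derivative of `θ₁` with respect to `z`. -/
noncomputable def jacobiTheta₁' (z τ : ℂ) : ℂ :=
  deriv (fun w => jacobiTheta₁ w τ) z

/-- The normalised exponential `z ↦ exp(2πiz)`. -/
noncomputable def unitExp (z : ℂ) : ℂ := Complex.exp (2 * (π : ℂ) * Complex.I * z)

lemma unitExp_add (z w : ℂ) : unitExp (z + w) = unitExp z * unitExp w := by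
  rw [unitExp, unitExp, unitExp, mul_add, Complex.exp_add]

lemma unitExp_zero : unitExp 0 = 1 := by simp [unitExp]

lemma unitExp_ne_zero (z : ℂ) : unitExp z ≠ 0 := Complex.exp_ne_zero _

lemma unitExp_intCast (m : ℤ) : unitExp m = 1 := by
  rw [unitExp, mul_comm, Complex.exp_int_mul_two_pi_mul_I]

lemma unitExp_half : unitExp (1 / 2) = -1 := by
  rw [unitExp, ← Complex.exp_pi_mul_I]
  congr 1
  ring

lemma differentiable_unitExp : Differentiable ℂ unitExp := by
  unfold unitExp
  fun_prop

/-- Horizontal integrals over one period of an entire `1`-periodic function do not depend on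
the line of integration. -/
lemma integral_comp_add_eq_of_periodic {g : ℂ → ℂ} (hg : Differentiable ℂ g)
    (hper : ∀ z, g (z + 1) = g z) (w : ℂ) :
    ∫ t in (0 : ℝ)..1, g (t + w) = ∫ t in (0 : ℝ)..1, g t := by
  have hrect := Complex.integral_boundary_rect_eq_zero_of_differentiableOn g 0 (1 + w.im * I)
    hg.differentiableOn
  have hside : ∀ s : ℝ, g (1 + s * I) = g (s * I) := fun s => by rw [add_comm, hper]
  simp [hside] at hrect
  have hreal : Function.Periodic (fun t : ℝ => g (t + w.im * I)) 1 := fun t => by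
    simp only
    rw [← hper (t + w.im * I)]
    congr 1
    push_cast
    ring
  have hshift := hreal.intervalIntegral_add_eq w.re 0
  have hsub := intervalIntegral.integral_comp_add_right (a := 0) (b := 1)
    (fun t : ℝ => g (t + w.im * I)) w.re
  rw [zero_add, add_comm 1, hshift, zero_add, ← sub_eq_zero.1 hrect] at hsub
  rw [← hsub]
  congr 1
  ext t
  congr 1
  conv_lhs => rw [← Complex.re_add_im w]
  push_cast
  ring

/-- A continuous `1`-periodic function on the real line all of whose Fourier coefficients vanish
is zero. -/
lemma eq_zero_of_integral_mul_unitExp_eq_zero {f : ℝ → ℂ} (hf : Continuous f)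
    (hper : Function.Periodic f 1)
    (h : ∀ m : ℤ, ∫ t in (0 : ℝ)..1, unitExp (-(m * t)) * f t = 0) (t : ℝ) : f t = 0 := by
  have : Fact ((0 : ℝ) < 1) := ⟨one_pos⟩
  let F : C(AddCircle (1 : ℝ), ℂ) := ⟨hper.lift, continuous_coinduced_dom.mpr hf⟩
  have hcoeff : fourierCoeff F = 0 := by
    ext m
    rw [fourierCoeff_eq_intervalIntegral _ _ 0]
    simp only [Pi.zero_apply, zero_add, one_div, inv_one, one_smul]
    rw [← h m]
    congr 1
    ext s
    rw [fourier_coe_apply, unitExp, smul_eq_mul]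
    congr 2
    push_cast
    ring
  have hsum := has_pointwise_sum_fourier_series_of_summable (f := F)
    (by rw [hcoeff]; exact summable_zero) (t : AddCircle (1 : ℝ))
  rw [hcoeff] at hsum
  simp only [Pi.zero_apply, zero_smul] at hsum
  exact hsum.unique hasSum_zero

/-- Entire functions with the quasi-periodicity of `x ↦ θ₁(x + b; τ)`. -/
structure IsThetaLike (τ b : ℂ) (h : ℂ → ℂ) : Prop where
  differentiable : Differentiable ℂ h
  add_one : ∀ x, h (x + 1) = -h x
  add_tau : ∀ x, h (x + τ) = -unitExp (-(τ / 2 + x + b)) * h x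

lemma IsThetaLike.sub_mul {τ b : ℂ} {h₁ h₂ : ℂ → ℂ} (H₁ : IsThetaLike τ b h₁)
    (H₂ : IsThetaLike τ b h₂) (c₁ c₂ : ℂ) :
    IsThetaLike τ b (fun x => c₁ * h₁ x - c₂ * h₂ x) where
  differentiable := (H₁.differentiable.const_mul c₁).sub (H₂.differentiable.const_mul c₂)
  add_one x := by rw [H₁.add_one, H₂.add_one]; ring
  add_tau x := by rw [H₁.add_tau, H₂.add_tau]; ring

lemma IsThetaLike.eq_zero {τ b : ℂ} {h : ℂ → ℂ} (H : IsThetaLike τ b h)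
    (h₀ : ∫ t in (0 : ℝ)..1, unitExp (-(1 / 2 * t)) * h t = 0) (w : ℂ) : h w = 0 := by
  let g : ℤ → ℂ → ℂ := fun m z => unitExp (-((m + 1 / 2) * z)) * h z
  have hgd : ∀ m, Differentiable ℂ (g m) := fun m =>
    (differentiable_unitExp.comp (by fun_prop)).mul H.differentiable
  have hgper : ∀ m z, g m (z + 1) = g m z := fun m z => by
    simp only [g]
    rw [H.add_one, show -((m + 1 / 2) * (z + 1)) =
      -((m + 1 / 2) * z) + (((-m - 1 : ℤ) : ℂ) + 1 / 2) by push_cast; ring, unitExp_add,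
      unitExp_add _ (1 / 2), unitExp_intCast, unitExp_half]
    ring
  have hgtau : ∀ m z, g m (z + τ) = -unitExp (-((m + 1) * τ + b)) * g (m + 1) z := fun m z => by
    simp only [g]
    rw [H.add_tau]
    have : unitExp (-((m + 1 / 2) * (z + τ))) * unitExp (-(τ / 2 + z + b)) =
        unitExp (-((m + 1) * τ + b)) * unitExp (-(((m + 1 : ℤ) + 1 / 2) * z)) := by
      rw [← unitExp_add, ← unitExp_add]
      congr 1
      push_cast
      ring
    linear_combination -h z * this
  have hrec : ∀ m, ∫ t in (0 : ℝ)..1, g m t =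
      -unitExp (-((m + 1) * τ + b)) * ∫ t in (0 : ℝ)..1, g (m + 1) t := fun m => by
    rw [← integral_comp_add_eq_of_periodic (hgd m) (hgper m) τ,
      ← intervalIntegral.integral_const_mul]
    simp only [hgtau]
  have hzero : ∀ m, ∫ t in (0 : ℝ)..1, g m t = 0 := fun m => by
    induction m using Int.induction_on with
    | zero => simpa [g] using h₀
    | succ i ih =>
      have := hrec i
      rw [ih] at this
      exact (mul_eq_zero.1 this.symm).resolve_left (neg_ne_zero.2 (unitExp_ne_zero _))
    | pred i ih =>
      rw [hrec, sub_add_cancel, ih, mul_zero]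
  have hline := eq_zero_of_integral_mul_unitExp_eq_zero (f := fun t : ℝ => g 0 (t + w))
    ((hgd 0).continuous.comp (by fun_prop))
    (fun t => by
      simp only
      rw [← hgper 0 (t + w)]
      congr 1
      push_cast
      ring)
    (fun m => by
      have hg0 : ∀ t : ℝ, unitExp (-(m * t)) * g 0 (t + w) = unitExp (m * w) * g m (t + w) :=
        fun t => by
          simp only [g]
          rw [← mul_assoc, ← mul_assoc, ← unitExp_add, ← unitExp_add]
          congr 2
          push_cast
          ring
      simp only [hg0]
      rw [intervalIntegral.integral_const_mul,
        integral_comp_add_eq_of_periodic (hgd m) (hgper m) w, hzero, mul_zero]) 0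
  simp only [Complex.ofReal_zero, zero_add, g] at hline
  exact (mul_eq_zero.1 hline).resolve_left (unitExp_ne_zero _)

/-- Functions with the quasi-periodicity of a theta function form a space of dimension at most
one. -/
lemma IsThetaLike.mul_comm {τ b : ℂ} {h₁ h₂ : ℂ → ℂ} (H₁ : IsThetaLike τ b h₁)
    (H₂ : IsThetaLike τ b h₂) (x w : ℂ) : h₁ x * h₂ w = h₁ w * h₂ x := by
  let c : (ℂ → ℂ) → ℂ := fun h => ∫ t in (0 : ℝ)..1, unitExp (-(1 / 2 * t)) * h t
  have hint : ∀ h : ℂ → ℂ, Differentiable ℂ h → IntervalIntegrable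
      (fun t : ℝ => unitExp (-(1 / 2 * t)) * h t) MeasureTheory.volume 0 1 := fun h hd =>
    ((differentiable_unitExp.continuous.comp (by fun_prop)).mul
      (hd.continuous.comp Complex.continuous_ofReal)).intervalIntegrable _ _
  have hprop : ∀ z, c h₂ * h₁ z - c h₁ * h₂ z = 0 := by
    refine (H₁.sub_mul H₂ (c h₂) (c h₁)).eq_zero ?_
    have : ∀ t : ℝ, unitExp (-(1 / 2 * t)) * (c h₂ * h₁ t - c h₁ * h₂ t) =
        c h₂ * (unitExp (-(1 / 2 * t)) * h₁ t) - c h₁ * (unitExp (-(1 / 2 * t)) * h₂ t) :=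
      fun t => by ring
    simp only [this]
    rw [intervalIntegral.integral_sub ((hint h₁ H₁.differentiable).const_mul _)
      ((hint h₂ H₂.differentiable).const_mul _), intervalIntegral.integral_const_mul,
      intervalIntegral.integral_const_mul]
    exact sub_eq_zero.2 (_root_.mul_comm _ _)
  by_cases hc : c h₁ = 0
  · rw [H₁.eq_zero hc x, H₁.eq_zero hc w, zero_mul, zero_mul]
  · refine mul_left_cancel₀ hc ?_
    linear_combination h₁ w * hprop x - h₁ x * hprop w

/-- `θ₁` in terms of Mathlib's two-variable theta function. -/
lemma jacobiTheta₁_eq (z τ : ℂ) : jacobiTheta₁ z τ =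
    -I * (unitExp (τ / 8 + z / 2) * jacobiTheta₂ (z + 1 / 2 + τ / 2) τ) := by
  rw [jacobiTheta₁, jacobiTheta₂, ← tsum_mul_left (a := unitExp _)]
  refine congrArg (-I * ·) (tsum_congr fun m => ?_)
  have hsign : (-1 : ℂ) ^ m = unitExp (m * (1 / 2)) := by
    rw [← unitExp_half, unitExp, unitExp, ← Complex.exp_int_mul]
    congr 1
    ring
  rw [hsign, unitExp, unitExp, jacobiTheta₂_term, ← Complex.exp_add, ← Complex.exp_add,
    ← Complex.exp_add]
  congr 1
  ring

lemma jacobiTheta₁_add_one (z τ : ℂ) : jacobiTheta₁ (z + 1) τ = -jacobiTheta₁ z τ := by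
  rw [jacobiTheta₁_eq, jacobiTheta₁_eq,
    show τ / 8 + (z + 1) / 2 = τ / 8 + z / 2 + 1 / 2 by ring,
    show z + 1 + 1 / 2 + τ / 2 = z + 1 / 2 + τ / 2 + 1 by ring, jacobiTheta₂_add_left,
    unitExp_add _ (1 / 2), unitExp_half]
  ring

lemma jacobiTheta₁_add_tau (z τ : ℂ) :
    jacobiTheta₁ (z + τ) τ = -unitExp (-(τ / 2 + z)) * jacobiTheta₁ z τ := by
  rw [jacobiTheta₁_eq, jacobiTheta₁_eq,
    show z + τ + 1 / 2 + τ / 2 = z + 1 / 2 + τ / 2 + τ by ring, jacobiTheta₂_add_left']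
  have h₁ : Complex.exp (-π * I * (τ + 2 * (z + 1 / 2 + τ / 2))) = -unitExp (-(z + τ)) := by
    rw [show -unitExp (-(z + τ)) = unitExp (1 / 2 + -(z + τ)) by
      rw [unitExp_add, unitExp_half, neg_one_mul], unitExp]
    refine Complex.exp_eq_exp_iff_exists_int.2 ⟨-1, ?_⟩
    push_cast
    ring
  have h₂ : unitExp (τ / 8 + (z + τ) / 2) * unitExp (-(z + τ)) =
      unitExp (-(τ / 2 + z)) * unitExp (τ / 8 + z / 2) := by
    rw [← unitExp_add, ← unitExp_add]
    congr 1
    ring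
  rw [h₁]
  linear_combination I * jacobiTheta₂ (z + 1 / 2 + τ / 2) τ * h₂

lemma jacobiTheta₁_zero (τ : ℂ) : jacobiTheta₁ 0 τ = 0 := by
  have h₀ : jacobiTheta₂ (1 / 2 + τ / 2) τ = 0 := by
    have h₁ := jacobiTheta₂_neg_left (1 / 2 + τ / 2) τ
    have h₂ := jacobiTheta₂_add_left' (-(1 / 2 + τ / 2)) τ
    have h₃ : jacobiTheta₂ (-(1 / 2 + τ / 2) + τ) τ = jacobiTheta₂ (1 / 2 + τ / 2) τ := by
      rw [← jacobiTheta₂_add_left]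
      congr 1
      ring
    rw [h₁, h₃, show -π * I * (τ + 2 * -(1 / 2 + τ / 2)) = π * I by ring,
      Complex.exp_pi_mul_I] at h₂
    linear_combination h₂ / 2
  rw [jacobiTheta₁_eq, zero_add, h₀, mul_zero, mul_zero]

lemma differentiable_jacobiTheta₁ {τ : ℂ} (hτ : 0 < τ.im) :
    Differentiable ℂ (fun z => jacobiTheta₁ z τ) := by
  simp only [jacobiTheta₁_eq]
  refine Differentiable.const_mul (Differentiable.mul
    (differentiable_unitExp.comp (by fun_prop)) fun z => ?_) _
  exact DifferentiableAt.comp (g := fun w => jacobiTheta₂ w τ) (f := fun z => z + 1 / 2 + τ / 2) z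
    (differentiableAt_jacobiTheta₂_fst _ hτ) (by fun_prop)

lemma jacobiTheta₁_add_natCast (z τ : ℂ) (m : ℕ) :
    jacobiTheta₁ (z + m) τ = (-1) ^ m * jacobiTheta₁ z τ := by
  induction m with
  | zero => simp
  | succ m ih =>
    rw [Nat.cast_succ, ← add_assoc, jacobiTheta₁_add_one, ih]
    ring

lemma jacobiTheta₁_add_int_mul_tau (z τ : ℂ) (m : ℤ) : jacobiTheta₁ (z + m * τ) τ =
    (-1) ^ m * unitExp (-(m ^ 2 * τ / 2 + m * z)) * jacobiTheta₁ z τ := by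
  induction m using Int.induction_on generalizing z with
  | zero => simp [unitExp_zero]
  | succ i ih =>
    rw [show z + ((i + 1 : ℤ) : ℂ) * τ = z + τ + (i : ℤ) * τ by push_cast; ring, ih,
      jacobiTheta₁_add_tau, zpow_add_one₀ (by norm_num)]
    have : unitExp (-(((i : ℤ) : ℂ) ^ 2 * τ / 2 + (i : ℤ) * (z + τ))) *
        unitExp (-(τ / 2 + z)) =
        unitExp (-(((i + 1 : ℤ) : ℂ) ^ 2 * τ / 2 + (i + 1 : ℤ) * z)) := by
      rw [← unitExp_add]
      congr 1
      push_cast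
      ring
    rw [← this]
    ring
  | pred i ih =>
    have hz := jacobiTheta₁_add_tau (z - τ) τ
    rw [sub_add_cancel] at hz
    rw [show z + ((-i - 1 : ℤ) : ℂ) * τ = z - τ + (-i : ℤ) * τ by push_cast; ring, ih,
      hz, zpow_sub_one₀ (by norm_num)]
    have : unitExp (-(((-i : ℤ) : ℂ) ^ 2 * τ / 2 + (-i : ℤ) * (z - τ))) =
        unitExp (-(((-i - 1 : ℤ) : ℂ) ^ 2 * τ / 2 + (-i - 1 : ℤ) * z)) *
          unitExp (-(τ / 2 + (z - τ))) := by
      rw [← unitExp_add]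
      congr 1
      push_cast
      ring
    rw [this]
    norm_num
    ring

lemma isThetaLike_jacobiTheta₁ {τ : ℂ} (hτ : 0 < τ.im) (b : ℂ) :
    IsThetaLike τ b (fun x => jacobiTheta₁ (x + b) τ) where
  differentiable := (differentiable_jacobiTheta₁ hτ).comp (by fun_prop)
  add_one x := by rw [add_right_comm, jacobiTheta₁_add_one]
  add_tau x := by rw [add_right_comm, jacobiTheta₁_add_tau, add_assoc (τ / 2)]

lemma prod_ite_mul_eq_mul_prod_ite {n j : ℕ} (hj : j ∈ Finset.range n) (A B : ℕ → ℂ) (c : ℂ) :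
    ∏ i ∈ Finset.range n, (if i = j then c * B i else A i) =
      c * ∏ i ∈ Finset.range n, (if i = j then B i else A i) := by
  have hsplit : ∀ i, (if i = j then c * B i else A i) =
      (if i = j then c else 1) * (if i = j then B i else A i) := fun i => by
    split_ifs <;> simp
  simp only [hsplit]
  rw [Finset.prod_mul_distrib, Finset.prod_ite_eq', if_pos hj]

lemma prod_range_add_one_eq_mul (N : ℕ) (A : ℕ → ℂ) (c : ℂ) (hA : A (N + 1) = c * A 0) :
    ∏ i ∈ Finset.range (N + 1), A (i + 1) = c * ∏ i ∈ Finset.range (N + 1), A i := by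
  rw [Finset.prod_range_succ, Finset.prod_range_succ', hA]
  ring

lemma sum_prod_ite_range_add_one_eq_mul (N : ℕ) (A B : ℕ → ℂ) (c : ℂ)
    (hA : A (N + 1) = c * A 0) (hB : B (N + 1) = c * B 0) :
    ∑ j ∈ Finset.range (N + 1), ∏ i ∈ Finset.range (N + 1),
        (if i = j then B (i + 1) else A (i + 1)) =
      c * ∑ j ∈ Finset.range (N + 1), ∏ i ∈ Finset.range (N + 1),
        (if i = j then B i else A i) := by
  rw [Finset.sum_range_succ, Finset.sum_range_succ', mul_add, Finset.mul_sum]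
  congr 1
  · refine Finset.sum_congr rfl fun j hj => ?_
    have hjN : N ≠ j := (Finset.mem_range.1 hj).ne'
    rw [Finset.prod_range_succ, Finset.prod_range_succ' _ N, if_neg hjN, hA,
      if_neg (Nat.succ_ne_zero j).symm]
    simp only [add_left_inj]
    ring
  · rw [Finset.prod_range_succ, Finset.prod_range_succ' _ N, if_pos rfl, if_pos rfl, hB]
    have hprod : ∏ i ∈ Finset.range N, (if i = N then B (i + 1) else A (i + 1)) =
        ∏ i ∈ Finset.range N, (if i + 1 = 0 then B (i + 1) else A (i + 1)) :=
      Finset.prod_congr rfl fun i hi => by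
        rw [if_neg (Finset.mem_range.1 hi).ne, if_neg (Nat.succ_ne_zero i)]
    rw [hprod]
    ring

lemma unitExp_natCast_mul_half (m : ℕ) : unitExp (m * (1 / 2)) = (-1) ^ m := by
  rw [← unitExp_half, unitExp, unitExp, ← Complex.exp_nat_mul]
  congr 1
  ring

lemma sum_unitExp_natCast_mul_div {n j : ℕ} (hj : j ∈ Finset.range n) :
    ∑ ν ∈ Finset.range n, unitExp (j * ((ν : ℂ) / n)) = if j = 0 then (n : ℂ) else 0 := by
  have hn : n ≠ 0 := by rintro rfl; simp at hj
  split_ifs with h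
  · subst h
    simp [unitExp_zero]
  · have hprim := Complex.isPrimitiveRoot_exp n hn
    have hne := hprim.pow_ne_one_of_pos_of_lt h (Finset.mem_range.1 hj)
    have hterm : ∀ ν : ℕ, unitExp (j * ((ν : ℂ) / n)) =
        (Complex.exp (2 * π * I / n) ^ j) ^ ν := fun ν => by
      rw [unitExp, ← Complex.exp_nat_mul, ← Complex.exp_nat_mul]
      congr 1
      ring
    simp only [hterm]
    rw [geom_sum_eq hne, pow_right_comm, hprim.pow_eq_one, one_pow, sub_self, zero_div]

/-- The product of the translates of `θ₁(·; (N+1)τ)` by `0, τ, …, Nτ`, normalised so as to be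
proportional to `θ₁(·; τ)`. -/
noncomputable def thetaProd (N : ℕ) (τ x : ℂ) : ℂ :=
  unitExp (N / 2 * x) * ∏ i ∈ Finset.range (N + 1), jacobiTheta₁ (x + i * τ) ((N + 1 : ℕ) * τ)

/-- The sum over `j` of `thetaProd` with its `j`-th factor twisted by `v`; it is proportional to
`θ₁(· + v; τ)`. -/
noncomputable def thetaTwistedSum (N : ℕ) (τ v x : ℂ) : ℂ :=
  unitExp (N / 2 * x) * ∑ j ∈ Finset.range (N + 1), ∏ i ∈ Finset.range (N + 1),
    (if i = j then unitExp (i * v) * jacobiTheta₁ (x + i * τ + (N + 1 : ℕ) * v) ((N + 1 : ℕ) * τ)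
      else jacobiTheta₁ (x + i * τ) ((N + 1 : ℕ) * τ))

lemma im_natCast_succ_mul_pos (N : ℕ) {τ : ℂ} (hτ : 0 < τ.im) :
    0 < (((N + 1 : ℕ) : ℂ) * τ).im := by
  rw [← Complex.ofReal_natCast, Complex.im_ofReal_mul]
  positivity

lemma unitExp_natCast_div_two_mul_add_one (N : ℕ) (x : ℂ) :
    unitExp (N / 2 * (x + 1)) = unitExp (N / 2 * x) * (-1) ^ N := by
  rw [← unitExp_natCast_mul_half, ← unitExp_add]
  congr 1
  ring

lemma isThetaLike_thetaProd (N : ℕ) {τ : ℂ} (hτ : 0 < τ.im) :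
    IsThetaLike τ 0 (thetaProd N τ) where
  differentiable := by
    refine (differentiable_unitExp.comp (by fun_prop)).mul
      (Differentiable.fun_finsetProd fun i _ => ?_)
    exact (differentiable_jacobiTheta₁ (im_natCast_succ_mul_pos N hτ)).comp
      (by fun_prop : Differentiable ℂ fun x : ℂ => x + i * τ)
  add_one x := by
    have hfac : ∀ i : ℕ, jacobiTheta₁ (x + 1 + i * τ) ((N + 1 : ℕ) * τ) =
        -1 * jacobiTheta₁ (x + i * τ) ((N + 1 : ℕ) * τ) := fun i => by
      rw [add_right_comm, jacobiTheta₁_add_one, neg_one_mul]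
    simp only [thetaProd, hfac]
    rw [Finset.prod_mul_distrib, Finset.prod_const, Finset.card_range,
      unitExp_natCast_div_two_mul_add_one]
    have : ((-1 : ℂ) ^ N) * (-1) ^ (N + 1) = -1 := by
      rw [pow_succ, ← mul_assoc, ← mul_pow]; norm_num
    linear_combination unitExp (N / 2 * x) *
      (∏ i ∈ Finset.range (N + 1), jacobiTheta₁ (x + i * τ) ((N + 1 : ℕ) * τ)) * this
  add_tau x := by
    have hfac : ∀ i : ℕ, x + τ + i * τ = x + (i + 1 : ℕ) * τ := fun i => by push_cast; ring
    simp only [thetaProd, hfac]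
    rw [prod_range_add_one_eq_mul N (fun i => jacobiTheta₁ (x + i * τ) ((N + 1 : ℕ) * τ))
      (-unitExp (-((N + 1 : ℕ) * τ / 2 + x)))
      (by rw [jacobiTheta₁_add_tau, Nat.cast_zero, zero_mul, add_zero])]
    have : unitExp (N / 2 * (x + τ)) * unitExp (-((N + 1 : ℕ) * τ / 2 + x)) =
        unitExp (-(τ / 2 + x + 0)) * unitExp (N / 2 * x) := by
      rw [← unitExp_add, ← unitExp_add]
      congr 1
      push_cast
      ring
    linear_combination
      -(∏ i ∈ Finset.range (N + 1), jacobiTheta₁ (x + i * τ) ((N + 1 : ℕ) * τ)) * this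

lemma isThetaLike_thetaTwistedSum (N : ℕ) {τ : ℂ} (hτ : 0 < τ.im) (v : ℂ) :
    IsThetaLike τ v (thetaTwistedSum N τ v) where
  differentiable := by
    have hd := differentiable_jacobiTheta₁ (im_natCast_succ_mul_pos N hτ)
    refine (differentiable_unitExp.comp (by fun_prop)).mul
      (Differentiable.fun_sum fun j _ => Differentiable.fun_finsetProd fun i _ => ?_)
    split_ifs
    · exact (hd.comp (by fun_prop :
        Differentiable ℂ fun x : ℂ => x + i * τ + (N + 1 : ℕ) * v)).const_mul _
    · exact hd.comp (by fun_prop : Differentiable ℂ fun x : ℂ => x + i * τ)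
  add_one x := by
    have hfac : ∀ i j : ℕ, (if i = j then
          unitExp (i * v) * jacobiTheta₁ (x + 1 + i * τ + (N + 1 : ℕ) * v) ((N + 1 : ℕ) * τ)
        else jacobiTheta₁ (x + 1 + i * τ) ((N + 1 : ℕ) * τ)) =
        -1 * (if i = j then
          unitExp (i * v) * jacobiTheta₁ (x + i * τ + (N + 1 : ℕ) * v) ((N + 1 : ℕ) * τ)
        else jacobiTheta₁ (x + i * τ) ((N + 1 : ℕ) * τ)) := fun i j => by
      rw [add_right_comm x 1, jacobiTheta₁_add_one, add_right_comm _ 1, jacobiTheta₁_add_one]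
      split_ifs <;> ring
    simp only [thetaTwistedSum, hfac]
    simp only [Finset.prod_mul_distrib, Finset.prod_const, Finset.card_range, ← Finset.mul_sum]
    rw [unitExp_natCast_div_two_mul_add_one]
    have : ((-1 : ℂ) ^ N) * (-1) ^ (N + 1) = -1 := by
      rw [pow_succ, ← mul_assoc, ← mul_pow]; norm_num
    rw [mul_assoc (unitExp _), ← mul_assoc (_ ^ N), this]
    ring
  add_tau x := by
    have hfac : ∀ i : ℕ, x + τ + i * τ = x + (i + 1 : ℕ) * τ := fun i => by push_cast; ring
    have hexp : ∀ i : ℕ, unitExp (i * v) = unitExp (-v) * unitExp ((i + 1 : ℕ) * v) := fun i => by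
      rw [← unitExp_add]
      congr 1
      push_cast
      ring
    have hshift := sum_prod_ite_range_add_one_eq_mul N
      (fun i => jacobiTheta₁ (x + i * τ) ((N + 1 : ℕ) * τ))
      (fun i => unitExp (i * v) *
        jacobiTheta₁ (x + i * τ + (N + 1 : ℕ) * v) ((N + 1 : ℕ) * τ))
      (-unitExp (-((N + 1 : ℕ) * τ / 2 + x)))
      (by rw [jacobiTheta₁_add_tau, Nat.cast_zero, zero_mul, add_zero])
      (by
        rw [add_right_comm, jacobiTheta₁_add_tau, Nat.cast_zero, zero_mul, zero_mul, add_zero,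
          unitExp_zero]
        have : unitExp ((N + 1 : ℕ) * v) *
            unitExp (-((N + 1 : ℕ) * τ / 2 + (x + (N + 1 : ℕ) * v))) =
            unitExp (-((N + 1 : ℕ) * τ / 2 + x)) := by
          rw [← unitExp_add]
          congr 1
          ring
        linear_combination
          -jacobiTheta₁ (x + (N + 1 : ℕ) * v) ((N + 1 : ℕ) * τ) * this)
    have hpull : ∑ j ∈ Finset.range (N + 1), ∏ i ∈ Finset.range (N + 1),
        (if i = j then unitExp (i * v) *
            jacobiTheta₁ (x + (i + 1 : ℕ) * τ + (N + 1 : ℕ) * v) ((N + 1 : ℕ) * τ)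
          else jacobiTheta₁ (x + (i + 1 : ℕ) * τ) ((N + 1 : ℕ) * τ)) =
        unitExp (-v) * ∑ j ∈ Finset.range (N + 1), ∏ i ∈ Finset.range (N + 1),
        (if i = j then unitExp ((i + 1 : ℕ) * v) *
            jacobiTheta₁ (x + (i + 1 : ℕ) * τ + (N + 1 : ℕ) * v) ((N + 1 : ℕ) * τ)
          else jacobiTheta₁ (x + (i + 1 : ℕ) * τ) ((N + 1 : ℕ) * τ)) := by
      rw [Finset.mul_sum]
      refine Finset.sum_congr rfl fun j hj => ?_
      rw [← prod_ite_mul_eq_mul_prod_ite hj]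
      refine Finset.prod_congr rfl fun i _ => ?_
      rw [hexp i, mul_assoc]
    simp only [thetaTwistedSum, hfac]
    rw [hpull, hshift]
    have : unitExp (N / 2 * (x + τ)) * unitExp (-v) * unitExp (-((N + 1 : ℕ) * τ / 2 + x)) =
        unitExp (-(τ / 2 + x + v)) * unitExp (N / 2 * x) := by
      rw [← unitExp_add, ← unitExp_add, ← unitExp_add]
      congr 1
      push_cast
      ring
    rw [neg_mul, neg_mul, ← mul_assoc (unitExp (-(τ / 2 + x + v))), ← this]
    ring

/-- The product of the translates of `θ₁(·; (N+1)τ)` by `τ, …, Nτ`. -/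
noncomputable def thetaProdTail (N : ℕ) (τ x : ℂ) : ℂ :=
  ∏ i ∈ Finset.range N, jacobiTheta₁ (x + (i + 1 : ℕ) * τ) ((N + 1 : ℕ) * τ)

lemma thetaProd_eq (N : ℕ) (τ x : ℂ) : thetaProd N τ x =
    unitExp (N / 2 * x) * thetaProdTail N τ x * jacobiTheta₁ x ((N + 1 : ℕ) * τ) := by
  rw [thetaProd, Finset.prod_range_succ', Nat.cast_zero, zero_mul, add_zero, mul_assoc,
    thetaProdTail]

lemma thetaTwistedSum_zero (N : ℕ) (τ v : ℂ) : thetaTwistedSum N τ v 0 =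
    thetaProdTail N τ 0 * jacobiTheta₁ ((N + 1 : ℕ) * v) ((N + 1 : ℕ) * τ) := by
  rw [thetaTwistedSum, Finset.sum_range_succ', Finset.sum_eq_zero, Finset.prod_range_succ']
  · simp [unitExp_zero, thetaProdTail]
  · intro j _
    rw [Finset.prod_range_succ', if_neg (Nat.succ_ne_zero j).symm]
    simp [jacobiTheta₁_zero]

lemma sum_thetaTwistedSum (N : ℕ) (τ x y : ℂ) :
    ∑ ν ∈ Finset.range (N + 1), (-1) ^ ν * thetaTwistedSum N τ (y + (ν : ℂ) / (N + 1 : ℕ)) x =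
      (N + 1 : ℕ) * (unitExp (N / 2 * x) * thetaProdTail N τ x *
        jacobiTheta₁ (x + (N + 1 : ℕ) * y) ((N + 1 : ℕ) * τ)) := by
  have hN : ((N + 1 : ℕ) : ℂ) ≠ 0 := Nat.cast_ne_zero.2 N.succ_ne_zero
  let W : ℕ → ℂ := fun j => ∏ i ∈ Finset.range (N + 1),
    (if i = j then unitExp (i * y) * jacobiTheta₁ (x + i * τ + (N + 1 : ℕ) * y) ((N + 1 : ℕ) * τ)
      else jacobiTheta₁ (x + i * τ) ((N + 1 : ℕ) * τ))
  have hterm : ∀ ν : ℕ, (-1) ^ ν * thetaTwistedSum N τ (y + (ν : ℂ) / (N + 1 : ℕ)) x =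
      unitExp (N / 2 * x) * ∑ j ∈ Finset.range (N + 1),
        unitExp (j * ((ν : ℂ) / (N + 1 : ℕ))) * W j := fun ν => by
    rw [thetaTwistedSum, mul_left_comm, Finset.mul_sum]
    congr 1
    refine Finset.sum_congr rfl fun j hj => ?_
    rw [← prod_ite_mul_eq_mul_prod_ite hj, ← prod_ite_mul_eq_mul_prod_ite hj]
    refine Finset.prod_congr rfl fun i _ => ?_
    split_ifs with hij
    · subst hij
      rw [mul_add (i : ℂ), unitExp_add, mul_add ((N + 1 : ℕ) : ℂ), mul_div_cancel₀ _ hN, ← add_assoc,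
        jacobiTheta₁_add_natCast]
      have : ((-1 : ℂ) ^ ν) * (-1) ^ ν = 1 := by rw [← mul_pow]; norm_num
      linear_combination unitExp (i * y) * unitExp (i * ((ν : ℂ) / (N + 1 : ℕ))) *
        jacobiTheta₁ (x + i * τ + (N + 1 : ℕ) * y) ((N + 1 : ℕ) * τ) * this
    · rfl
  have hW : W 0 = thetaProdTail N τ x *
      jacobiTheta₁ (x + (N + 1 : ℕ) * y) ((N + 1 : ℕ) * τ) := by
    simp only [W]
    rw [Finset.prod_range_succ']
    simp [unitExp_zero, thetaProdTail]
  simp only [hterm]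
  rw [← Finset.mul_sum, Finset.sum_comm]
  simp only [← Finset.sum_mul]
  rw [Finset.sum_congr rfl fun j hj => by rw [sum_unitExp_natCast_mul_div hj]]
  simp only [ite_mul, zero_mul]
  rw [Finset.sum_ite_eq', if_pos (Finset.mem_range.2 N.succ_pos), hW]
  ring

lemma thetaProdTail_zero_mul_sum (N : ℕ) {τ : ℂ} (hτ : 0 < τ.im) (x y : ℂ)
    (hy : ∀ ν ∈ Finset.range (N + 1), jacobiTheta₁ (y + (ν : ℂ) / (N + 1 : ℕ)) τ ≠ 0) :
    thetaProdTail N τ 0 * jacobiTheta₁ ((N + 1 : ℕ) * y) ((N + 1 : ℕ) * τ) *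
        ∑ ν ∈ Finset.range (N + 1), jacobiTheta₁ (x + y + (ν : ℂ) / (N + 1 : ℕ)) τ /
          jacobiTheta₁ (y + (ν : ℂ) / (N + 1 : ℕ)) τ =
      (N + 1 : ℕ) * (unitExp (N / 2 * x) * thetaProdTail N τ x *
        jacobiTheta₁ (x + (N + 1 : ℕ) * y) ((N + 1 : ℕ) * τ)) := by
  have hN : ((N + 1 : ℕ) : ℂ) ≠ 0 := Nat.cast_ne_zero.2 N.succ_ne_zero
  rw [← sum_thetaTwistedSum, Finset.mul_sum]
  refine Finset.sum_congr rfl fun ν hν => ?_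
  have hprop := (isThetaLike_thetaTwistedSum N hτ (y + (ν : ℂ) / (N + 1 : ℕ))).mul_comm
    (isThetaLike_jacobiTheta₁ hτ _) x 0
  rw [zero_add, thetaTwistedSum_zero, mul_add ((N + 1 : ℕ) : ℂ), mul_div_cancel₀ _ hN,
    jacobiTheta₁_add_natCast, ← add_assoc] at hprop
  rw [← mul_div_assoc, div_eq_iff (hy ν hν), mul_assoc ((-1) ^ ν), hprop]
  have : ((-1 : ℂ) ^ ν) * (-1) ^ ν = 1 := by rw [← mul_pow]; norm_num
  linear_combination -thetaProdTail N τ 0 * jacobiTheta₁ ((N + 1 : ℕ) * y) ((N + 1 : ℕ) * τ) *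
    jacobiTheta₁ (x + y + (ν : ℂ) / (N + 1 : ℕ)) τ * this

lemma eventually_ne_zero_of_differentiable {f : ℂ → ℂ} (hf : Differentiable ℂ f) {a : ℂ}
    (ha : f a ≠ 0) (z : ℂ) : ∀ᶠ w in nhdsWithin z {z}ᶜ, f w ≠ 0 := by
  have han : AnalyticOnNhd ℂ f Set.univ := fun w _ => hf.analyticAt w
  refine (han z trivial).eventually_eq_zero_or_eventually_ne_zero.resolve_left fun h => ha ?_
  exact han.eqOn_zero_of_preconnected_of_eventuallyEq_zero isPreconnected_univ trivial h trivial

lemma eventually_jacobiTheta₁_mul_add_ne_zero {τ a : ℂ} (hτ : 0 < τ.im)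
    (ha : jacobiTheta₁ a τ ≠ 0) {c : ℂ} (hc : c ≠ 0) (b : ℂ) :
    ∀ᶠ w in nhdsWithin (0 : ℂ) {0}ᶜ, jacobiTheta₁ (c * w + b) τ ≠ 0 := by
  refine eventually_ne_zero_of_differentiable (f := fun w => jacobiTheta₁ (c * w + b) τ)
    ((differentiable_jacobiTheta₁ hτ).comp (by fun_prop : Differentiable ℂ fun w : ℂ => c * w + b))
    (a := (a - b) / c) ?_ 0
  simpa only [mul_div_cancel₀ _ hc, sub_add_cancel] using ha

lemma thetaProdTail_zero_ne_zero (N : ℕ) {τ a b : ℂ} (hτ : 0 < τ.im)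
    (ha : jacobiTheta₁ a τ ≠ 0) (hb : jacobiTheta₁ b ((N + 1 : ℕ) * τ) ≠ 0) :
    thetaProdTail N τ 0 ≠ 0 := by
  have hN : ((N + 1 : ℕ) : ℂ) ≠ 0 := Nat.cast_ne_zero.2 N.succ_ne_zero
  have hNτ := im_natCast_succ_mul_pos N hτ
  obtain ⟨x, hx⟩ := ((Finset.eventually_all (Finset.range N)).2 fun i _ =>
    eventually_jacobiTheta₁_mul_add_ne_zero hNτ hb one_ne_zero ((i + 1 : ℕ) * τ)).exists
  obtain ⟨y, hy, hxy⟩ := (((Finset.eventually_all (Finset.range (N + 1))).2 fun ν _ =>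
    eventually_jacobiTheta₁_mul_add_ne_zero hτ ha one_ne_zero ((ν : ℂ) / (N + 1 : ℕ))).and
    (eventually_jacobiTheta₁_mul_add_ne_zero hNτ hb hN x)).exists
  simp only [one_mul] at hx hy
  intro h
  have hsum := thetaProdTail_zero_mul_sum N hτ x y hy
  rw [h, zero_mul, zero_mul, add_comm x] at hsum
  exact mul_ne_zero hN (mul_ne_zero (mul_ne_zero (unitExp_ne_zero _)
    (Finset.prod_ne_zero_iff.2 hx)) hxy) hsum.symm

lemma hasDerivAt_jacobiTheta₁ {τ : ℂ} (hτ : 0 < τ.im) (z : ℂ) :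
    HasDerivAt (fun w => jacobiTheta₁ w τ) (jacobiTheta₁' z τ) z :=
  (differentiable_jacobiTheta₁ hτ z).hasDerivAt

lemma thetaProd_mul_jacobiTheta₁'_zero (N : ℕ) {τ : ℂ} (hτ : 0 < τ.im) (x : ℂ) :
    thetaProd N τ x * jacobiTheta₁' 0 τ =
      thetaProdTail N τ 0 * jacobiTheta₁' 0 ((N + 1 : ℕ) * τ) * jacobiTheta₁ x τ := by
  have hNτ := im_natCast_succ_mul_pos N hτ
  have hprop : ∀ w, thetaProd N τ x * jacobiTheta₁ w τ =
      thetaProd N τ w * jacobiTheta₁ x τ := fun w => by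
    simpa only [add_zero] using
      (isThetaLike_thetaProd N hτ).mul_comm (isThetaLike_jacobiTheta₁ hτ 0) x w
  have hd : Differentiable ℂ fun w => unitExp (N / 2 * w) * thetaProdTail N τ w := by
    refine (differentiable_unitExp.comp (by fun_prop)).mul
      (Differentiable.fun_finsetProd fun i _ => ?_)
    exact (differentiable_jacobiTheta₁ hNτ).comp
      (by fun_prop : Differentiable ℂ fun x : ℂ => x + (i + 1 : ℕ) * τ)
  have hleft := (hasDerivAt_jacobiTheta₁ hτ 0).const_mul (thetaProd N τ x)
  have hright := ((hd 0).hasDerivAt.mul (hasDerivAt_jacobiTheta₁ hNτ 0)).mul_const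
    (jacobiTheta₁ x τ)
  rw [jacobiTheta₁_zero, mul_zero, zero_add, mul_zero, unitExp_zero, one_mul] at hright
  refine hleft.unique (hright.congr_of_eventuallyEq (Filter.Eventually.of_forall fun w => ?_))
  simp only [hprop w, thetaProd_eq N τ w, Pi.mul_apply]

/-- The case `k = 0` of the summation identity. -/
lemma sum_theta_ratio_eq (N : ℕ) {x y τ : ℂ} (hτ : 0 < τ.im)
    (hx : jacobiTheta₁ x τ ≠ 0)
    (hy : ∀ ν ∈ Finset.range (N + 1), jacobiTheta₁ (y + (ν : ℂ) / (N + 1 : ℕ)) τ ≠ 0)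
    (hx' : jacobiTheta₁ x ((N + 1 : ℕ) * τ) ≠ 0)
    (hy' : jacobiTheta₁ ((N + 1 : ℕ) * y) ((N + 1 : ℕ) * τ) ≠ 0) :
    1 / ((N + 1 : ℕ) : ℂ) * ∑ ν ∈ Finset.range (N + 1),
        jacobiTheta₁ (x + y + (ν : ℂ) / (N + 1 : ℕ)) τ * jacobiTheta₁' 0 τ /
          (jacobiTheta₁ x τ * jacobiTheta₁ (y + (ν : ℂ) / (N + 1 : ℕ)) τ) =
      jacobiTheta₁ (x + (N + 1 : ℕ) * y) ((N + 1 : ℕ) * τ) *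
          jacobiTheta₁' 0 ((N + 1 : ℕ) * τ) /
        (jacobiTheta₁ x ((N + 1 : ℕ) * τ) *
          jacobiTheta₁ ((N + 1 : ℕ) * y) ((N + 1 : ℕ) * τ)) := by
  have hN : ((N + 1 : ℕ) : ℂ) ≠ 0 := Nat.cast_ne_zero.2 N.succ_ne_zero
  have hM := thetaProdTail_zero_ne_zero N hτ hx hx'
  have hsum := thetaProdTail_zero_mul_sum N hτ x y hy
  have hder := thetaProd_mul_jacobiTheta₁'_zero N hτ x
  rw [thetaProd_eq] at hder
  have hterm : ∀ ν : ℕ, jacobiTheta₁ (x + y + (ν : ℂ) / (N + 1 : ℕ)) τ * jacobiTheta₁' 0 τ /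
      (jacobiTheta₁ x τ * jacobiTheta₁ (y + (ν : ℂ) / (N + 1 : ℕ)) τ) =
      jacobiTheta₁' 0 τ / jacobiTheta₁ x τ *
        (jacobiTheta₁ (x + y + (ν : ℂ) / (N + 1 : ℕ)) τ /
          jacobiTheta₁ (y + (ν : ℂ) / (N + 1 : ℕ)) τ) := fun ν => by
    rw [div_mul_div_comm, _root_.mul_comm (jacobiTheta₁ _ _) (jacobiTheta₁' _ _)]
  simp only [hterm]
  rw [← Finset.mul_sum]
  generalize ∑ ν ∈ Finset.range (N + 1), jacobiTheta₁ (x + y + (ν : ℂ) / (N + 1 : ℕ)) τ /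
    jacobiTheta₁ (y + (ν : ℂ) / (N + 1 : ℕ)) τ = S at hsum ⊢
  rw [← mul_assoc, one_div, ← div_eq_inv_mul, div_div, div_mul_eq_mul_div,
    div_eq_div_iff (mul_ne_zero hx hN) (mul_ne_zero hx' hy')]
  refine mul_left_cancel₀ hM ?_
  linear_combination jacobiTheta₁' 0 τ * jacobiTheta₁ x ((N + 1 : ℕ) * τ) * hsum +
    (N + 1 : ℕ) * jacobiTheta₁ (x + (N + 1 : ℕ) * y) ((N + 1 : ℕ) * τ) * hder

/-- Summation identity for ratios of theta functions (sum over roots of unity shifts). -/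
theorem theta_summation_identity_one (k : ℤ) (n : ℕ) (hn : 1 ≤ n) (x y τ : ℂ)
    (hτ : 0 < τ.im)
    (hx : jacobiTheta₁ x τ ≠ 0)
    (hy : ∀ ν ∈ Finset.range n, jacobiTheta₁ (y + (ν : ℂ) / (n : ℂ)) τ ≠ 0)
    (hx' : jacobiTheta₁ (x + (k : ℂ) * τ) ((n : ℂ) * τ) ≠ 0)
    (hy' : jacobiTheta₁ ((n : ℂ) * y) ((n : ℂ) * τ) ≠ 0) :
    (1 / (n : ℂ)) * ∑ ν ∈ Finset.range n,
        Complex.exp (-2 * (π : ℂ) * Complex.I * (k : ℂ) * (ν : ℂ) / (n : ℂ)) *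
          (jacobiTheta₁ (x + y + (ν : ℂ) / (n : ℂ)) τ * jacobiTheta₁' 0 τ) /
          (jacobiTheta₁ x τ * jacobiTheta₁ (y + (ν : ℂ) / (n : ℂ)) τ)
      = Complex.exp (2 * (π : ℂ) * Complex.I * (k : ℂ) * y) *
          (jacobiTheta₁ (x + (n : ℂ) * y + (k : ℂ) * τ) ((n : ℂ) * τ) *
              jacobiTheta₁' 0 ((n : ℂ) * τ)) /
          (jacobiTheta₁ (x + (k : ℂ) * τ) ((n : ℂ) * τ) *
              jacobiTheta₁ ((n : ℂ) * y) ((n : ℂ) * τ)) := by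
  obtain ⟨N, rfl⟩ : ∃ N, n = N + 1 := ⟨n - 1, by omega⟩
  have hE : ((-1 : ℂ) ^ k) * unitExp (-(k ^ 2 * τ / 2 + k * x)) ≠ 0 :=
    mul_ne_zero (zpow_ne_zero _ (by norm_num)) (unitExp_ne_zero _)
  have hxk := jacobiTheta₁_add_int_mul_tau x τ k
  have hxk0 : jacobiTheta₁ (x + k * τ) τ ≠ 0 := by
    rw [hxk]
    exact mul_ne_zero hE hx
  have hmain := sum_theta_ratio_eq N hτ hxk0 hy hx' hy'
  have hky : Complex.exp (2 * (π : ℂ) * Complex.I * (k : ℂ) * y) = unitExp (k * y) := by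
    rw [unitExp]
    congr 1
    ring
  rw [hky, add_right_comm x, mul_div_assoc, ← hmain, mul_left_comm (unitExp _), Finset.mul_sum _ _ (unitExp _)]
  congr 1
  refine Finset.sum_congr rfl fun ν hν => ?_
  rw [add_right_comm x (k * τ), add_right_comm (x + y) (k * τ), jacobiTheta₁_add_int_mul_tau _ τ k,
    hxk]
  have hexp : Complex.exp (-2 * (π : ℂ) * Complex.I * (k : ℂ) * (ν : ℂ) / ((N + 1 : ℕ) : ℂ)) *
      unitExp (-(k ^ 2 * τ / 2 + k * x)) =
      unitExp (k * y) * unitExp (-(k ^ 2 * τ / 2 + k * (x + y + (ν : ℂ) / (N + 1 : ℕ)))) := by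
    rw [← unitExp_add, unitExp, unitExp, ← Complex.exp_add]
    congr 1
    ring
  rw [← mul_div_assoc, mul_assoc _ (jacobiTheta₁ x τ), div_eq_div_iff
    (mul_ne_zero hx (hy ν hν)) (mul_ne_zero hE (mul_ne_zero hx (hy ν hν)))]
  linear_combination (-1) ^ k * jacobiTheta₁ (x + y + (ν : ℂ) / (N + 1 : ℕ)) τ *
    jacobiTheta₁' 0 τ * jacobiTheta₁ x τ * jacobiTheta₁ (y + (ν : ℂ) / (N + 1 : ℕ)) τ * hexp
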